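/- Let X be a nonzero non-Archimedean strictly convex normed space over a normed field K. Then the valuation of K is trivial: ‖λ‖ = 1 for every nonzero λ ∈ K. (Equivalently, Kubzdela's observation: the only non-Archimedean strictly convex space over a field with a non-trivial valuation is the zero space.) -/

import Mathlib

theorem norm_add_eq_left_of_norm_lt {X : Type*} [SeminormedAddCommGroup X]
    (hNA : ∀ x y : X, ‖x + y‖ ≤ max ‖x‖ ‖y‖) {a b : X} (h : ‖b‖ < ‖a‖) :
    ‖a + b‖ = ‖a‖ := by
  refine le_antisymm ((hNA a b).trans_eq (max_eq_left h.le)) ?_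
  have key := hNA (a + b) (-b)
  rw [add_neg_cancel_right, norm_neg] at key
  exact (le_max_iff.mp key).resolve_right h.not_ge

/-- If a non-Archimedean strictly convex normed space over a normed
field `K` is nonzero, then the valuation of `K` is trivial: `‖λ‖ = 1` for every
nonzero `λ ∈ K`. -/
theorem strictly_convex_trivial_valuation
    (K : Type*) [NormedField K] (X : Type*) [NormedAddCommGroup X] [NormedSpace K X]
    (hNA : ∀ x y : X, ‖x + y‖ ≤ max ‖x‖ ‖y‖)
    (hSC1 : ‖(2 : K)‖ = 1)
    (hSC2 : ∀ x y : X, ‖x‖ = ‖y‖ → ‖y‖ = ‖x + y‖ → x = y)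
    (hX : ∃ x : X, x ≠ 0) :
    ∀ lam : K, lam ≠ 0 → ‖lam‖ = 1 := by
  obtain ⟨x, hx⟩ := hX
  have hxpos : 0 < ‖x‖ := norm_pos_iff.mpr hx
  have one_le_norm (c : K) (hc : c ≠ 0) : 1 ≤ ‖c‖ := by
    by_contra! hlt
    have hcx : ‖c • x‖ < ‖x‖ := by
      rw [norm_smul]
      exact mul_lt_of_lt_one_left hxpos hlt
    have h2x : ‖(2 : K) • x‖ = ‖x‖ := by rw [norm_smul, hSC1, one_mul]
    have h₁ : ‖x + c • x‖ = ‖x‖ := norm_add_eq_left_of_norm_lt hNA hcx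
    have h₂ : ‖x + (x + c • x)‖ = ‖x‖ := by
      rw [← add_assoc, ← two_smul K x,
        norm_add_eq_left_of_norm_lt hNA (hcx.trans_eq h2x.symm), h2x]
    have hzero : c • x = 0 := left_eq_add.mp (hSC2 x (x + c • x) h₁.symm (h₁.trans h₂.symm))
    exact smul_ne_zero hc hx hzero
  intro lam hlam
  refine le_antisymm ?_ (one_le_norm lam hlam)
  have hinv := one_le_norm lam⁻¹ (inv_ne_zero hlam)
  rw [norm_inv] at hinv
  exact (one_le_inv₀ (norm_pos_iff.mpr hlam)).mp hinv
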